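/- arXiv:math/0007072 — 5 statements merged into one kernel-verified Lean document; each statement's English description precedes it below -/
import Mathlib

section
/- Let r ≥ 1 and let J be an ideal of ℂ[Z_1,Z_2,Z_3] generated by monomials, containing I(o) = ⟨Z_1^{r+1}, Z_2^{r+1}, Z_3^{r+1}, Z_1Z_2Z_3⟩, such that the A_r(3)-module ℂ[Z_1,Z_2,Z_3]/J is isomorphic to the regular representation of A_r(3). Then there exist integers l_1, l_2, l_3 with 1 ≤ l_i ≤ r+1 and l_1 + l_2 + l_3 ∈ {2(r+1)+1, 2(r+1)+2} such that J is the ideal generated by Z_1^{l_1}, Z_2^{l_2}, Z_3^{l_3}, (Z_2Z_3)^{r+2-l_1}, (Z_1Z_3)^{r+2-l_2}, (Z_1Z_2)^{r+2-l_3}, and Z_1Z_2Z_3. -/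
open MvPolynomial

noncomputable section

/-- The abelian group `A_r(n)`: diagonal matrices (encoded as tuples of units)
`d` with `d i ^ (r+1) = 1` for all `i` and `∏ i, d i = 1` (determinant one). -/
def ArGroup (r n : ℕ) : Subgroup (Fin n → ℂˣ) where
  carrier := {d | (∀ i, d i ^ (r + 1) = 1) ∧ ∏ i, d i = 1}
  one_mem' := ⟨fun _ => one_pow _, Finset.prod_const_one⟩
  mul_mem' := by
    rintro a b ⟨ha1, ha2⟩ ⟨hb1, hb2⟩
    refine ⟨fun i => ?_, ?_⟩
    · simp [Pi.mul_apply, mul_pow, ha1 i, hb1 i]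
    · simp [Finset.prod_mul_distrib, ha2, hb2]
  inv_mem' := by
    rintro a ⟨ha1, ha2⟩
    refine ⟨fun i => ?_, ?_⟩
    · rw [Pi.inv_apply, inv_pow, ha1 i, inv_one]
    · simp [Finset.prod_inv_distrib, ha2]

/-- The action of a diagonal element `d` on polynomials, `Z i ↦ d i • Z i`. -/
def actA {n : ℕ} (d : Fin n → ℂˣ) :
    MvPolynomial (Fin n) ℂ →ₐ[ℂ] MvPolynomial (Fin n) ℂ :=
  aeval fun i => C (d i : ℂ) * X i

/-- The `ρ`-isotypic component (as a set) of the `A_r(n)`-module `ℂ[Z]/I`: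
those classes `w` such that for every `g` in the group and every representative `p`
of `w`, the class of `g · p` equals `ρ(g) • w`. -/
def iso (r n : ℕ) (I : Ideal (MvPolynomial (Fin n) ℂ)) (ρ : ArGroup r n →* ℂˣ) :
    Set (MvPolynomial (Fin n) ℂ ⧸ I) :=
  {w | ∀ g : ArGroup r n, ∀ p, Ideal.Quotient.mk I p = w →
    Ideal.Quotient.mk I (actA (g : Fin n → ℂˣ) p) = (ρ g : ℂ) • w}

end

/-- `P` is the indicator of a down-closed set of exponents of monomials in three variables, with
all entries below `n` and some entry zero, that is a transversal of `ℤ³ / (nℤ³ + ℤ(1,1,1))`. -/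
structure IsStaircaseTransversal (n : ℕ) (P : ℕ → ℕ → ℕ → Prop) : Prop where
  mono : ∀ {a b c a' b' c'}, P a b c → a' ≤ a → b' ≤ b → c' ≤ c → P a' b' c'
  bound : ∀ {a b c}, P a b c → a < n ∧ b < n ∧ c < n ∧ (a = 0 ∨ b = 0 ∨ c = 0)
  unique : ∀ {a b c a' b' c'}, P a b c → P a' b' c' →
    a + b' ≡ a' + b [MOD n] → b + c' ≡ b' + c [MOD n] → a = a' ∧ b = b' ∧ c = c'
  exist : ∀ x y z, ∃ a b c, P a b c ∧ a + y ≡ x + b [MOD n] ∧ b + z ≡ y + c [MOD n]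

namespace IsStaircaseTransversal

variable {n : ℕ} {P : ℕ → ℕ → ℕ → Prop}

lemma modEq_trans_sub {a b c x y z : ℕ} (h₁ : a + y ≡ x + b [MOD n])
    (h₂ : b + z ≡ y + c [MOD n]) : a + z ≡ x + c [MOD n] := by
  have h := h₁.add h₂
  have e₁ : a + y + (b + z) = (a + z) + (y + b) := by ring
  have e₂ : x + b + (y + c) = (x + c) + (y + b) := by ring
  rw [e₁, e₂] at h
  exact Nat.ModEq.add_right_cancel' _ h

lemma modEq_swap {a b x y : ℕ} (h : a + y ≡ x + b [MOD n]) : b + x ≡ y + a [MOD n] := by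
  rw [add_comm b x, add_comm y a]; exact h.symm

lemma modEq_cases {a b x y : ℕ} (ha : a < n) (hb : b < n) (hx : x < n) (hy : y < n)
    (h : a + y ≡ x + b [MOD n]) :
    a + y = x + b ∨ a + y = x + b + n ∨ a + y + n = x + b := by
  obtain ⟨k, hk⟩ := (Nat.modEq_iff_dvd.1 h)
  push_cast at hk
  have h₁ : k < 2 := by
    by_contra! hc
    nlinarith
  have h₂ : -2 < k := by
    by_contra! hc
    nlinarith
  obtain rfl | rfl | rfl : k = -1 ∨ k = 0 ∨ k = 1 := by omega
  all_goals omega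

lemma rotate (h : IsStaircaseTransversal n P) :
    IsStaircaseTransversal n fun a b c => P b c a where
  mono hP ha hb hc := h.mono hP hb hc ha
  bound hP := by have := h.bound hP; omega
  unique {a b c a' b' c'} hP hP' h₁ h₂ := by
    have := h.unique hP hP' h₂ (modEq_swap (modEq_trans_sub h₁ h₂))
    omega
  exist x y z := by
    obtain ⟨b, c, a, hP, h₁, h₂⟩ := h.exist y z x
    exact ⟨a, b, c, hP, modEq_swap (modEq_trans_sub h₁ h₂), h₁⟩

lemma swap (h : IsStaircaseTransversal n P) :
    IsStaircaseTransversal n fun a b c => P a c b where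
  mono hP ha hb hc := h.mono hP ha hc hb
  bound hP := by have := h.bound hP; omega
  unique {a b c a' b' c'} hP hP' h₁ h₂ := by
    have := h.unique hP hP' (modEq_trans_sub h₁ h₂) (modEq_swap h₂)
    omega
  exist x y z := by
    obtain ⟨a, c, b, hP, h₁, h₂⟩ := h.exist x z y
    exact ⟨a, b, c, hP, modEq_trans_sub h₁ h₂, modEq_swap h₂⟩

lemma exists_length (h : IsStaircaseTransversal n P) :
    ∃ l, 1 ≤ l ∧ l ≤ n ∧ ∀ a, P a 0 0 ↔ a < l := by
  classical
  have hn : ∃ a, ¬ P a 0 0 := ⟨n, fun hP => by have := h.bound hP; omega⟩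
  have hlt (a : ℕ) : P a 0 0 ↔ a < Nat.find hn := by
    rw [Nat.lt_find_iff]
    exact ⟨fun hP m hm => not_not.2 (h.mono hP hm le_rfl le_rfl), fun hm => not_not.1 (hm a le_rfl)⟩
  obtain ⟨a, b, c, hP, -⟩ := h.exist 0 0 0
  have h0 := (hlt 0).1 (h.mono hP a.zero_le b.zero_le c.zero_le)
  refine ⟨Nat.find hn, h0, Nat.find_min' hn fun hP => ?_, hlt⟩
  have := h.bound hP
  omega

lemma eq_of_sub_eq (h : IsStaircaseTransversal n P) {a b c a' b' c' : ℕ} (hP : P a b c)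
    (hP' : P a' b' c') (h₁ : a + b' = a' + b ∨ a + b' = a' + b + n ∨ a + b' + n = a' + b)
    (h₂ : b + c' = b' + c ∨ b + c' = b' + c + n ∨ b + c' + n = b' + c) :
    a = a' ∧ b = b' ∧ c = c' := by
  refine h.unique hP hP' ?_ ?_
  · rcases h₁ with h₁ | h₁ | h₁
    · rw [h₁]
    · simp [Nat.ModEq, h₁]
    · simp [Nat.ModEq, ← h₁]
  · rcases h₂ with h₂ | h₂ | h₂
    · rw [h₂]
    · simp [Nat.ModEq, h₂]
    · simp [Nat.ModEq, ← h₂]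

/-- Every class with representative `(0, x, y)`, `x ≤ y < n`, is represented by one of the three
elements of that class having a zero entry and all entries below `n`. -/
lemma mem_cases (h : IsStaircaseTransversal n P) {x y : ℕ} (hxy : x ≤ y) (hy : y < n) :
    P 0 x y ∨ (1 ≤ x ∧ P (n - x) 0 (y - x)) ∨ (x < y ∧ P (n - y) (n + x - y) 0) := by
  obtain ⟨a, b, c, hP, h₁, h₂⟩ := h.exist 0 x y
  obtain ⟨ha, hb, hc, h0⟩ := h.bound hP
  have e₁ := modEq_cases ha hb (by omega) (by omega) h₁
  have e₂ := modEq_cases hb hc (by omega) hy h₂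
  have : (a = 0 ∧ b = x ∧ c = y) ∨ (1 ≤ x ∧ a = n - x ∧ b = 0 ∧ c = y - x) ∨
      (x < y ∧ a = n - y ∧ b = n + x - y ∧ c = 0) := by omega
  rcases this with ⟨rfl, rfl, rfl⟩ | ⟨hx, rfl, rfl, rfl⟩ | ⟨hx, rfl, rfl, rfl⟩
  · exact .inl hP
  · exact .inr (.inl ⟨hx, hP⟩)
  · exact .inr (.inr ⟨hx, hP⟩)

lemma not_diagonal (h : IsStaircaseTransversal n P) {l a b c : ℕ} (hl : 1 ≤ l) (hln : l ≤ n)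
    (h₁ : ∀ a, P a 0 0 ↔ a < l) (hP : P a b c) : ¬ (n + 1 - l ≤ b ∧ n + 1 - l ≤ c) := by
  rintro ⟨hb, hc⟩
  have hP' := h.mono hP a.zero_le hb hc
  have := h.eq_of_sub_eq hP' ((h₁ (l - 1)).2 (by omega)) (by omega) (by omega)
  omega

lemma mem_of_le (h : IsStaircaseTransversal n P) {l₁ l₃ : ℕ} (hl₁ : l₁ ≤ n) (hl₃ : l₃ ≤ n)
    (h₁ : ∀ a, P a 0 0 ↔ a < l₁) (h₃ : ∀ a, P 0 0 a ↔ a < l₃)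
    {b c : ℕ} (hbc : b ≤ c) (hc : c < l₃) (hd : b < n + 1 - l₁) : P 0 b c := by
  rcases h.mem_cases hbc (by omega) with hP | ⟨hb, hP⟩ | ⟨hb, hP⟩
  · exact hP
  · have := (h₁ _).1 (h.mono hP le_rfl le_rfl (Nat.zero_le _))
    omega
  · rcases Nat.eq_zero_or_pos b with rfl | hb0
    · exact (h₃ c).2 hc
    have hP' := h.mono hP le_rfl (show n - c ≤ n + b - c by omega) le_rfl
    have := h.eq_of_sub_eq hP' ((h₃ c).2 hc) (by omega) (by omega)
    omega

lemma mem_of_lt (h : IsStaircaseTransversal n P) {l₁ l₂ l₃ : ℕ} (hl₁ : l₁ ≤ n) (hl₂ : l₂ ≤ n)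
    (hl₃ : l₃ ≤ n)
    (h₁ : ∀ a, P a 0 0 ↔ a < l₁) (h₂ : ∀ a, P 0 a 0 ↔ a < l₂) (h₃ : ∀ a, P 0 0 a ↔ a < l₃)
    {b c : ℕ} (hb : b < l₂) (hc : c < l₃) (hd : ¬ (n + 1 - l₁ ≤ b ∧ n + 1 - l₁ ≤ c)) :
    P 0 b c := by
  rcases le_total b c with hbc | hbc
  · exact h.mem_of_le hl₁ hl₃ h₁ h₃ hbc hc (by omega)
  · exact h.swap.mem_of_le hl₁ hl₂ h₁ h₂ hbc hb (by omega)

lemma exists_lengths (h : IsStaircaseTransversal n P) :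
    ∃ l₁ l₂ l₃ : ℕ, (1 ≤ l₁ ∧ l₁ ≤ n) ∧ (1 ≤ l₂ ∧ l₂ ≤ n) ∧ (1 ≤ l₃ ∧ l₃ ≤ n) ∧
      (l₁ + l₂ + l₃ = 2 * n + 1 ∨ l₁ + l₂ + l₃ = 2 * n + 2) ∧
      ∀ a b c, P a b c ↔ a < l₁ ∧ b < l₂ ∧ c < l₃ ∧
        ¬ (n + 1 - l₁ ≤ b ∧ n + 1 - l₁ ≤ c) ∧ ¬ (n + 1 - l₂ ≤ a ∧ n + 1 - l₂ ≤ c) ∧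
        ¬ (n + 1 - l₃ ≤ a ∧ n + 1 - l₃ ≤ b) ∧ (a = 0 ∨ b = 0 ∨ c = 0) := by
  obtain ⟨l₁, p₁, q₁, h₁⟩ := h.exists_length
  obtain ⟨l₂, p₂, q₂, h₂⟩ := h.rotate.rotate.exists_length
  obtain ⟨l₃, p₃, q₃, h₃⟩ := h.rotate.exists_length
  have hmem (a b c : ℕ) (hP : P a b c) : a < l₁ ∧ b < l₂ ∧ c < l₃ ∧
        ¬ (n + 1 - l₁ ≤ b ∧ n + 1 - l₁ ≤ c) ∧ ¬ (n + 1 - l₂ ≤ a ∧ n + 1 - l₂ ≤ c) ∧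
        ¬ (n + 1 - l₃ ≤ a ∧ n + 1 - l₃ ≤ b) ∧ (a = 0 ∨ b = 0 ∨ c = 0) := by
    have d₁ := h.not_diagonal p₁ q₁ h₁ hP
    have d₂ := h.rotate.rotate.not_diagonal p₂ q₂ h₂ hP
    have d₃ := h.rotate.not_diagonal p₃ q₃ h₃ hP
    exact ⟨(h₁ a).1 (h.mono hP le_rfl b.zero_le c.zero_le),
      (h₂ b).1 (h.mono hP a.zero_le le_rfl c.zero_le),
      (h₃ c).1 (h.mono hP a.zero_le b.zero_le le_rfl), d₁, by omega, d₃, (h.bound hP).2.2.2⟩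
  refine ⟨l₁, l₂, l₃, ⟨p₁, q₁⟩, ⟨p₂, q₂⟩, ⟨p₃, q₃⟩, ?_, fun a b c => ⟨hmem a b c, ?_⟩⟩
  · have lower : 2 * n < l₁ + l₂ + l₃ := by
      by_contra! hle
      rcases q₃.lt_or_eq with hlt | heq
      · rcases h.mem_cases (x := l₃ + l₂ - n) (y := l₃) (by omega) hlt with hP | ⟨-, hP⟩ | ⟨-, hP⟩
        all_goals have := hmem _ _ _ hP; omega
      · rcases h.mem_cases (x := n - l₁) (y := n - l₁) (by omega) (by omega) with hP | ⟨-, hP⟩ | ⟨-, hP⟩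
        all_goals have := hmem _ _ _ hP; omega
    have upper : l₁ + l₂ + l₃ < 2 * n + 3 := by
      by_contra! hle
      rcases h.mem_cases (x := n + 1 - l₁) (y := 2 * n + 2 - l₁ - l₂) (by omega) (by omega) with
        hP | ⟨-, hP⟩ | ⟨-, hP⟩
      all_goals have := hmem _ _ _ hP; omega
    omega
  · rintro ⟨ha, hb, hc, d₁, d₂, d₃, rfl | rfl | rfl⟩
    · exact h.mem_of_lt q₁ q₂ q₃ h₁ h₂ h₃ hb hc d₁
    · exact h.rotate.rotate.mem_of_lt q₂ q₃ q₁ h₂ h₃ h₁ hc ha (by omega)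
    · exact h.rotate.mem_of_lt q₃ q₁ q₂ h₃ h₁ h₂ ha hb d₃

end IsStaircaseTransversal

/-- The character `g ↦ ∏ i, g i ^ m i` by which `A_r(n)` acts on the monomial `Z ^ m`. -/
noncomputable def ArGroup.monomialChar {r n : ℕ} (m : Fin n →₀ ℕ) : ArGroup r n →* ℂˣ where
  toFun g := ∏ i, (g : Fin n → ℂˣ) i ^ m i
  map_one' := by simp
  map_mul' g h := by simp [mul_pow, Finset.prod_mul_distrib]

lemma actA_monomial {r n : ℕ} (g : ArGroup r n) (m : Fin n →₀ ℕ) (c : ℂ) :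
    actA (g : Fin n → ℂˣ) (monomial m c) =
      monomial m ((ArGroup.monomialChar m g : ℂ) * c) := by
  rw [actA, aeval_monomial, Finsupp.prod_fintype _ _ (by simp), monomial_eq (s := m),
    Finsupp.prod_fintype _ _ (by simp)]
  simp only [mul_pow, Finset.prod_mul_distrib, ArGroup.monomialChar, MonoidHom.coe_mk,
    OneHom.coe_mk, Units.coe_prod, Units.val_pow_eq_pow_val, map_mul, map_prod, map_pow,
    MvPolynomial.algebraMap_eq]
  ring

lemma coeff_actA {r n : ℕ} (g : ArGroup r n) (m : Fin n →₀ ℕ) (p : MvPolynomial (Fin n) ℂ) :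
    coeff m (actA (g : Fin n → ℂˣ) p) = (ArGroup.monomialChar m g : ℂ) * coeff m p := by
  classical
  induction p using MvPolynomial.induction_on' with
  | monomial u a =>
    rw [actA_monomial, coeff_monomial, coeff_monomial]
    split_ifs with h <;> simp [h]
  | add p q hp hq => simp [hp, hq, mul_add]

/-- An ideal is monomial when it contains exactly the polynomials all of whose monomials
it contains. -/
def IsMonomialIdeal {n : ℕ} (J : Ideal (MvPolynomial (Fin n) ℂ)) : Prop :=
  ∀ p, p ∈ J ↔ ∀ m ∈ p.support, monomial m (1 : ℂ) ∈ J

lemma isMonomialIdeal_span {n : ℕ} (T : Set (Fin n →₀ ℕ)) :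
    IsMonomialIdeal
      (Ideal.span ((fun m => (monomial m (1 : ℂ) : MvPolynomial (Fin n) ℂ)) '' T)) := by
  classical
  intro p
  simp [mem_ideal_span_monomial_image, support_monomial]

namespace IsMonomialIdeal

variable {r n : ℕ} {J : Ideal (MvPolynomial (Fin n) ℂ)}

lemma monomial_mem (hJ : IsMonomialIdeal J) {p : MvPolynomial (Fin n) ℂ} (hp : p ∈ J)
    {m : Fin n →₀ ℕ} (hm : coeff m p ≠ 0) : monomial m (1 : ℂ) ∈ J :=
  (hJ p).1 hp m (mem_support_iff.2 hm)

lemma actA_mem (hJ : IsMonomialIdeal J) (g : ArGroup r n) {p : MvPolynomial (Fin n) ℂ}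
    (hp : p ∈ J) : actA (g : Fin n → ℂˣ) p ∈ J := by
  refine (hJ _).2 fun m hm => hJ.monomial_mem hp fun h0 => ?_
  rw [mem_support_iff, coeff_actA, h0, mul_zero] at hm
  exact hm rfl

lemma mk_monomial_mem_iso (hJ : IsMonomialIdeal J) {ρ : ArGroup r n →* ℂˣ} {m : Fin n →₀ ℕ}
    (hρ : ArGroup.monomialChar m = ρ) : Ideal.Quotient.mk J (monomial m 1) ∈ iso r n J ρ := by
  subst hρ
  intro g p hp
  have h := hJ.actA_mem g (Ideal.Quotient.eq.1 hp)
  rw [map_sub, ← Ideal.Quotient.eq, actA_monomial] at h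
  rw [h, ← smul_eq_mul, ← smul_monomial]
  rfl

/-- Two monomials outside `J` with the same character coincide when every isotypic component
is at most one-dimensional. -/
lemma eq_of_monomialChar_eq (hJ : IsMonomialIdeal J) {m k : Fin n →₀ ℕ}
    {w : MvPolynomial (Fin n) ℂ ⧸ J}
    (hw : ∀ w' ∈ iso r n J (ArGroup.monomialChar m), ∃ a : ℂ, w' = a • w)
    (hm : monomial m (1 : ℂ) ∉ J) (hk : monomial k (1 : ℂ) ∉ J)
    (hmk : ArGroup.monomialChar (r := r) k = ArGroup.monomialChar m) : m = k := by
  classical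
  by_contra hne
  obtain ⟨a, ha⟩ := hw _ (hJ.mk_monomial_mem_iso rfl)
  obtain ⟨b, hb⟩ := hw _ (hJ.mk_monomial_mem_iso hmk)
  have ha0 : a ≠ 0 := by
    rintro rfl
    rw [zero_smul] at ha
    exact hm (Ideal.Quotient.eq_zero_iff_mem.1 ha)
  have h : Ideal.Quotient.mk J (a • monomial k 1) = Ideal.Quotient.mk J (b • monomial m 1) := by
    change a • Ideal.Quotient.mk J (monomial k 1) = b • Ideal.Quotient.mk J (monomial m 1)
    rw [ha, hb, smul_smul, smul_smul, mul_comm]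
  refine hk (hJ.monomial_mem (Ideal.Quotient.eq.1 h) ?_)
  simp [coeff_monomial, hne, ha0]

/-- A character occurring in the quotient by `J` is the character of a monomial outside `J`. -/
lemma exists_monomialChar_eq (hJ : IsMonomialIdeal J) {ρ : ArGroup r n →* ℂˣ}
    {w : MvPolynomial (Fin n) ℂ ⧸ J} (hw : w ∈ iso r n J ρ) (hw0 : w ≠ 0) :
    ∃ m, monomial m (1 : ℂ) ∉ J ∧ ArGroup.monomialChar m = ρ := by
  obtain ⟨p, rfl⟩ := Ideal.Quotient.mk_surjective w
  have hp : p ∉ J := fun hp => hw0 (Ideal.Quotient.eq_zero_iff_mem.2 hp)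
  rw [hJ p] at hp
  push Not at hp
  obtain ⟨m, hm, hmJ⟩ := hp
  refine ⟨m, hmJ, MonoidHom.ext fun g => ?_⟩
  by_contra hne
  have h : actA (g : Fin n → ℂˣ) p - (ρ g : ℂ) • p ∈ J := Ideal.Quotient.eq.1 (hw g p rfl)
  refine hmJ (hJ.monomial_mem h ?_)
  rw [coeff_sub, coeff_actA, coeff_smul, smul_eq_mul, ← sub_mul]
  exact mul_ne_zero (sub_ne_zero.2 fun h => hne (Units.ext h)) (mem_support_iff.1 hm)

end IsMonomialIdeal

/-- The exponent vector `(a, b, c)`. -/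
noncomputable def exponent (a b c : ℕ) : Fin 3 →₀ ℕ := Finsupp.equivFunOnFinite.symm ![a, b, c]

lemma exponent_eq (m : Fin 3 →₀ ℕ) : exponent (m 0) (m 1) (m 2) = m := by
  ext i
  fin_cases i <;> rfl

lemma monomial_exponent (a b c : ℕ) :
    monomial (exponent a b c) (1 : ℂ) = X 0 ^ a * X 1 ^ b * X 2 ^ c := by
  rw [monomial_eq, Finsupp.prod_fintype _ _ (by simp), Fin.prod_univ_three]
  simp [exponent]

lemma monomialChar_exponent {r : ℕ} (a b c : ℕ) (g : ArGroup r 3) :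
    ArGroup.monomialChar (exponent a b c) g =
      (g : Fin 3 → ℂˣ) 0 ^ a * (g : Fin 3 → ℂˣ) 1 ^ b * (g : Fin 3 → ℂˣ) 2 ^ c := by
  simp [ArGroup.monomialChar, Fin.prod_univ_three, exponent]

lemma pow_eq_pow_of_modEq_units {r : ℕ} {u : ℂˣ} (hu : u ^ (r + 1) = 1) {a b : ℕ}
    (h : a ≡ b [MOD r + 1]) : u ^ a = u ^ b :=
  pow_eq_pow_iff_modEq.2 (h.of_dvd (orderOf_dvd_of_pow_eq_one hu))

lemma monomialChar_exponent_eq_iff {r a b c x y z : ℕ} :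
    ArGroup.monomialChar (r := r) (exponent a b c) = ArGroup.monomialChar (exponent x y z) ↔
      a + y ≡ x + b [MOD r + 1] ∧ b + z ≡ y + c [MOD r + 1] := by
  constructor
  · intro h
    obtain ⟨u, hu⟩ : ∃ u : ℂˣ, orderOf u = r + 1 := by
      have := Complex.isPrimitiveRoot_exp (r + 1) (by omega)
      exact ⟨this.isUnit (by omega) |>.unit, by
        rw [← orderOf_units, IsUnit.unit_spec, ← this.eq_orderOf]⟩
    have hu1 : u ^ (r + 1) = 1 := hu ▸ pow_orderOf_eq_one u
    have h₁ : ![u, u⁻¹, 1] ∈ ArGroup r 3 :=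
      ⟨fun i => by fin_cases i <;> simp [hu1], by simp [Fin.prod_univ_three]⟩
    have h₂ : ![1, u, u⁻¹] ∈ ArGroup r 3 :=
      ⟨fun i => by fin_cases i <;> simp [hu1], by simp [Fin.prod_univ_three]⟩
    have e₁ := DFunLike.congr_fun h ⟨_, h₁⟩
    have e₂ := DFunLike.congr_fun h ⟨_, h₂⟩
    simp only [monomialChar_exponent, Matrix.cons_val_zero, Matrix.cons_val_one,
      Matrix.cons_val, one_pow, mul_one, one_mul, inv_pow, ← div_eq_mul_inv,
      div_eq_div_iff_mul_eq_mul, ← pow_add] at e₁ e₂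
    rw [← hu]
    exact ⟨pow_eq_pow_iff_modEq.1 e₁, pow_eq_pow_iff_modEq.1 e₂⟩
  · rintro ⟨h₁, h₂⟩
    ext g : 1
    obtain ⟨g, hg, hdet⟩ := g
    rw [monomialChar_exponent, monomialChar_exponent]
    rw [Fin.prod_univ_three] at hdet
    have e₁ := pow_eq_pow_of_modEq_units (hg 0) (IsStaircaseTransversal.modEq_trans_sub h₁ h₂)
    have e₂ := pow_eq_pow_of_modEq_units (hg 1) h₂
    have e₃ : g 2 = (g 0 * g 1)⁻¹ := (inv_eq_of_mul_eq_one_right hdet).symm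
    simp only [e₃, inv_pow, mul_pow, ← div_eq_mul_inv, div_eq_div_iff_mul_eq_mul]
    calc g 0 ^ a * g 1 ^ b * (g 0 ^ z * g 1 ^ z) = g 0 ^ (a + z) * g 1 ^ (b + z) := by
          rw [pow_add, pow_add]; exact mul_mul_mul_comm _ _ _ _
      _ = g 0 ^ x * g 1 ^ y * (g 0 ^ c * g 1 ^ c) := by
          rw [e₁, e₂, pow_add, pow_add]; exact mul_mul_mul_comm _ _ _ _

lemma monomial_exponent_mem_of_le {J : Ideal (MvPolynomial (Fin 3) ℂ)} {a b c a' b' c' : ℕ}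
    (h : (X 0 ^ a * X 1 ^ b * X 2 ^ c : MvPolynomial (Fin 3) ℂ) ∈ J)
    (ha : a ≤ a') (hb : b ≤ b') (hc : c ≤ c') : monomial (exponent a' b' c') (1 : ℂ) ∈ J := by
  rw [monomial_exponent]
  exact J.mem_of_dvd
    (mul_dvd_mul (mul_dvd_mul (pow_dvd_pow _ ha) (pow_dvd_pow _ hb)) (pow_dvd_pow _ hc)) h

lemma IsMonomialIdeal.isStaircaseTransversal {r : ℕ} {J : Ideal (MvPolynomial (Fin 3) ℂ)}
    (hJ : IsMonomialIdeal J)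
    (hIo : Ideal.span {(X 0 : MvPolynomial (Fin 3) ℂ) ^ (r + 1), X 1 ^ (r + 1),
      X 2 ^ (r + 1), X 0 * X 1 * X 2} ≤ J)
    (hreg : ∀ ρ : ArGroup r 3 →* ℂˣ,
      ∃ w ∈ iso r 3 J ρ, w ≠ 0 ∧ ∀ w' ∈ iso r 3 J ρ, ∃ a : ℂ, w' = a • w) :
    IsStaircaseTransversal (r + 1) fun a b c => monomial (exponent a b c) (1 : ℂ) ∉ J where
  mono hP ha hb hc hmem := hP <| by
    rw [monomial_exponent] at hmem
    exact monomial_exponent_mem_of_le hmem ha hb hc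
  bound {a b c} hP := by
    rw [Ideal.span_le] at hIo
    have g₀ : (X 0 : MvPolynomial (Fin 3) ℂ) ^ (r + 1) ∈ J := hIo (by simp)
    have g₁ : (X 1 : MvPolynomial (Fin 3) ℂ) ^ (r + 1) ∈ J := hIo (by simp)
    have g₂ : (X 2 : MvPolynomial (Fin 3) ℂ) ^ (r + 1) ∈ J := hIo (by simp)
    have g₃ : (X 0 * X 1 * X 2 : MvPolynomial (Fin 3) ℂ) ∈ J := hIo (by simp)
    refine ⟨?_, ?_, ?_, ?_⟩
    · by_contra! h
      exact hP (monomial_exponent_mem_of_le (b := 0) (c := 0) (by simpa using g₀) h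
        b.zero_le c.zero_le)
    · by_contra! h
      exact hP (monomial_exponent_mem_of_le (a := 0) (c := 0) (by simpa using g₁) a.zero_le
        h c.zero_le)
    · by_contra! h
      exact hP (monomial_exponent_mem_of_le (a := 0) (b := 0) (by simpa using g₂) a.zero_le
        b.zero_le h)
    · by_contra! h
      exact hP (monomial_exponent_mem_of_le (a := 1) (b := 1) (c := 1) (by simpa using g₃)
        (by omega) (by omega) (by omega))
  unique {a b c a' b' c'} hP hP' h₁ h₂ := by
    obtain ⟨w, -, -, hw⟩ := hreg (ArGroup.monomialChar (exponent a' b' c'))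
    have h := hJ.eq_of_monomialChar_eq hw hP' hP (monomialChar_exponent_eq_iff.2 ⟨h₁, h₂⟩)
    exact ⟨(DFunLike.congr_fun h 0).symm, (DFunLike.congr_fun h 1).symm,
      (DFunLike.congr_fun h 2).symm⟩
  exist x y z := by
    obtain ⟨w, hw, hw0, -⟩ := hreg (ArGroup.monomialChar (exponent x y z))
    obtain ⟨m, hm, hmx⟩ := hJ.exists_monomialChar_eq hw hw0
    rw [← exponent_eq m] at hm hmx
    exact ⟨m 0, m 1, m 2, hm, monomialChar_exponent_eq_iff.1 hmx⟩

/-- Let `J` be a monomial ideal of `ℂ[Z_1,Z_2,Z_3]` containing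
`I(o)` whose quotient is the regular representation of `A_r(3)`. Then there are
integers `1 ≤ l_i ≤ r+1` with `l_1 + l_2 + l_3 ∈ {2(r+1)+1, 2(r+1)+2}` such that
`J = ⟨Z_1^(l_1), Z_2^(l_2), Z_3^(l_3), (Z_2Z_3)^(r+2−l_1), (Z_1Z_3)^(r+2−l_2),
(Z_1Z_2)^(r+2−l_3), Z_1Z_2Z_3⟩`. -/
theorem Ar3_monomial_ideal_classification (r : ℕ) (hr : 1 ≤ r)
    (J : Ideal (MvPolynomial (Fin 3) ℂ))
    (hmono : ∃ T : Set (Fin 3 →₀ ℕ),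
      J = Ideal.span ((fun m => (monomial m (1 : ℂ) : MvPolynomial (Fin 3) ℂ)) '' T))
    (hIo : Ideal.span {(X 0 : MvPolynomial (Fin 3) ℂ) ^ (r + 1), X 1 ^ (r + 1),
      X 2 ^ (r + 1), X 0 * X 1 * X 2} ≤ J)
    (hdim : Module.finrank ℂ (MvPolynomial (Fin 3) ℂ ⧸ J) = (r + 1) ^ 2)
    (hreg : ∀ ρ : ArGroup r 3 →* ℂˣ,
      ∃ w ∈ iso r 3 J ρ, w ≠ 0 ∧ ∀ w' ∈ iso r 3 J ρ, ∃ a : ℂ, w' = a • w) :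
    ∃ l1 l2 l3 : ℕ,
      (1 ≤ l1 ∧ l1 ≤ r + 1) ∧ (1 ≤ l2 ∧ l2 ≤ r + 1) ∧ (1 ≤ l3 ∧ l3 ≤ r + 1) ∧
      (l1 + l2 + l3 = 2 * (r + 1) + 1 ∨ l1 + l2 + l3 = 2 * (r + 1) + 2) ∧
      J = Ideal.span {(X 0 : MvPolynomial (Fin 3) ℂ) ^ l1, X 1 ^ l2, X 2 ^ l3,
        (X 1 * X 2) ^ (r + 2 - l1), (X 0 * X 2) ^ (r + 2 - l2),
        (X 0 * X 1) ^ (r + 2 - l3), X 0 * X 1 * X 2} := by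
  have hJ : IsMonomialIdeal J := by
    obtain ⟨T, rfl⟩ := hmono
    exact isMonomialIdeal_span T
  obtain ⟨l₁, l₂, l₃, b₁, b₂, b₃, hsum, hP⟩ :=
    (hJ.isStaircaseTransversal hIo hreg).exists_lengths
  refine ⟨l₁, l₂, l₃, b₁, b₂, b₃, hsum, le_antisymm ?_ ?_⟩
  · set K := Ideal.span {(X 0 : MvPolynomial (Fin 3) ℂ) ^ l₁, X 1 ^ l₂, X 2 ^ l₃,
        (X 1 * X 2) ^ (r + 2 - l₁), (X 0 * X 2) ^ (r + 2 - l₂),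
        (X 0 * X 1) ^ (r + 2 - l₃), X 0 * X 1 * X 2}
    have hgen (a b c : ℕ) (h : monomial (exponent a b c) (1 : ℂ) ∈ J) :
        monomial (exponent a b c) (1 : ℂ) ∈ K := by
      have hcases : l₁ ≤ a ∨ l₂ ≤ b ∨ l₃ ≤ c ∨ (r + 2 - l₁ ≤ b ∧ r + 2 - l₁ ≤ c) ∨
          (r + 2 - l₂ ≤ a ∧ r + 2 - l₂ ≤ c) ∨ (r + 2 - l₃ ≤ a ∧ r + 2 - l₃ ≤ b) ∨
          (1 ≤ a ∧ 1 ≤ b ∧ 1 ≤ c) := by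
        have := mt (hP a b c).2 (not_not.2 h)
        omega
      rcases hcases with h | h | h | ⟨h, h'⟩ | ⟨h, h'⟩ | ⟨h, h'⟩ | ⟨h, h', h''⟩
      · exact monomial_exponent_mem_of_le (b := 0) (c := 0)
          (Ideal.subset_span (by simp)) h b.zero_le c.zero_le
      · exact monomial_exponent_mem_of_le (a := 0) (c := 0)
          (Ideal.subset_span (by simp)) a.zero_le h c.zero_le
      · exact monomial_exponent_mem_of_le (a := 0) (b := 0)
          (Ideal.subset_span (by simp)) a.zero_le b.zero_le h
      · exact monomial_exponent_mem_of_le (a := 0)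
          (Ideal.subset_span (by simp [mul_pow])) a.zero_le h h'
      · exact monomial_exponent_mem_of_le (b := 0)
          (Ideal.subset_span (by simp [mul_pow])) h b.zero_le h'
      · exact monomial_exponent_mem_of_le (c := 0)
          (Ideal.subset_span (by simp [mul_pow])) h h' c.zero_le
      · exact monomial_exponent_mem_of_le (a := 1) (b := 1) (c := 1)
          (Ideal.subset_span (by simp)) h h' h''
    obtain ⟨T, hT⟩ := hmono
    have hTJ : ∀ m ∈ T, monomial m (1 : ℂ) ∈ J := fun m hm =>
      hT ▸ Ideal.subset_span ⟨m, hm, rfl⟩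
    rw [hT, Ideal.span_le]
    rintro _ ⟨m, hm, rfl⟩
    have := hTJ m hm
    rw [← exponent_eq m] at this
    simpa only [exponent_eq, SetLike.mem_coe] using hgen _ _ _ this
  · have hmem (a b c : ℕ) (h : ¬ (a < l₁ ∧ b < l₂ ∧ c < l₃ ∧
        ¬ (r + 1 + 1 - l₁ ≤ b ∧ r + 1 + 1 - l₁ ≤ c) ∧
        ¬ (r + 1 + 1 - l₂ ≤ a ∧ r + 1 + 1 - l₂ ≤ c) ∧
        ¬ (r + 1 + 1 - l₃ ≤ a ∧ r + 1 + 1 - l₃ ≤ b) ∧ (a = 0 ∨ b = 0 ∨ c = 0))) :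
        (X 0 ^ a * X 1 ^ b * X 2 ^ c : MvPolynomial (Fin 3) ℂ) ∈ J := by
      rw [← monomial_exponent]
      exact not_not.1 (mt (hP a b c).1 h)
    rw [Ideal.span_le]
    rintro _ (rfl | rfl | rfl | rfl | rfl | rfl | rfl)
    · simpa using hmem l₁ 0 0 (by omega)
    · simpa using hmem 0 l₂ 0 (by omega)
    · simpa using hmem 0 0 l₃ (by omega)
    · simpa [mul_pow] using hmem 0 (r + 2 - l₁) (r + 2 - l₁) (by omega)
    · simpa [mul_pow] using hmem (r + 2 - l₂) 0 (r + 2 - l₂) (by omega)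
    · simpa [mul_pow] using hmem (r + 2 - l₃) (r + 2 - l₃) 0 (by omega)
    · simpa using hmem 1 1 1 (by omega)
end

section
/- For n ≥ 2, let N := { x ∈ ℚ^n : 2x ∈ ℤ^n and x_1 + ⋯ + x_n ∈ ℤ } (the lattice exp^{-1}(A_1(n)) containing ℤ^n with index 2^{n-1}). Then for each index 1 ≤ i ≤ n, the n vectors e^i and v^{i,j} := (e^i + e^j)/2 for j ≠ i form a ℤ-basis of N. -/
/-- The lattice `N = exp⁻¹(A_r(n))`: vectors of `ℚ^n` whose coordinates lie in
`(1/(r+1))ℤ` and whose coordinate sum is an integer, as a `ℤ`-submodule of `ℚ^n`. -/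
def latticeN (r n : ℕ) : Submodule ℤ (Fin n → ℚ) where
  carrier := {x | (∀ i, ∃ m : ℤ, ((r : ℚ) + 1) * x i = (m : ℚ)) ∧
    ∃ m : ℤ, ∑ i, x i = (m : ℚ)}
  add_mem' := by
    rintro a b ⟨ha1, ha2⟩ ⟨hb1, hb2⟩
    constructor
    · intro i
      obtain ⟨ma, hma⟩ := ha1 i
      obtain ⟨mb, hmb⟩ := hb1 i
      exact ⟨ma + mb, by push_cast [Pi.add_apply]; rw [mul_add, hma, hmb]⟩
    · obtain ⟨ma, hma⟩ := ha2
      obtain ⟨mb, hmb⟩ := hb2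
      exact ⟨ma + mb, by push_cast [Pi.add_apply, Finset.sum_add_distrib]; rw [hma, hmb]⟩
  zero_mem' := by
    constructor
    · exact fun i => ⟨0, by simp⟩
    · exact ⟨0, by simp⟩
  smul_mem' := by
    rintro c a ⟨ha1, ha2⟩
    constructor
    · intro i
      obtain ⟨ma, hma⟩ := ha1 i
      refine ⟨c * ma, ?_⟩
      push_cast
      rw [Pi.smul_apply, zsmul_eq_mul]
      rw [mul_left_comm, hma]
    · obtain ⟨ma, hma⟩ := ha2
      refine ⟨c * ma, ?_⟩
      push_cast
      simp only [Pi.smul_apply, zsmul_eq_mul, ← Finset.mul_sum]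
      rw [hma]

/-- The vector `e^i` for `j = i`, and `(e^i + e^j)/2` for `j ≠ i`. -/
def halfSumFamily {n : ℕ} (i j : Fin n) : Fin n → ℚ :=
  if j = i then Pi.single i 1 else (1 / 2 : ℚ) • (Pi.single i 1 + Pi.single j 1)

lemma halfSumFamily_apply_of_ne {n : ℕ} {i k : Fin n} (j : Fin n) (hk : k ≠ i) :
    halfSumFamily i j k = if j = k then 1 / 2 else 0 := by
  unfold halfSumFamily
  split_ifs <;> simp_all [Pi.single_apply, eq_comm]

lemma sum_halfSumFamily {n : ℕ} (i j : Fin n) : ∑ k, halfSumFamily i j k = 1 := by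
  unfold halfSumFamily
  split_ifs with h
  · simp
  · norm_num [← Finset.mul_sum, Finset.sum_add_distrib]

lemma linearCombination_halfSumFamily_apply_of_ne {n : ℕ} {i k : Fin n} (c : Fin n → ℤ)
    (hk : k ≠ i) : (∑ j, c j • halfSumFamily i j) k = c k / 2 := by
  simp [Finset.sum_apply, halfSumFamily_apply_of_ne _ hk, div_eq_mul_inv]

lemma sum_linearCombination_halfSumFamily {n : ℕ} (i : Fin n) (c : Fin n → ℤ) :
    ∑ k, (∑ j, c j • halfSumFamily i j) k = ∑ j, (c j : ℚ) := by
  simp only [Finset.sum_apply, zsmul_eq_mul]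
  rw [Finset.sum_comm]
  simp [← Finset.mul_sum, sum_halfSumFamily]

/-- A vector is determined by its coordinate sum and all its coordinates but one. -/
lemma eq_of_sum_eq_of_forall_ne {ι M : Type*} [Fintype ι] [DecidableEq ι] [AddCommGroup M]
    {x y : ι → M} (i : ι) (hsum : ∑ k, x k = ∑ k, y k) (h : ∀ k, k ≠ i → x k = y k) :
    x = y := by
  funext k
  by_cases hk : k = i
  · subst hk
    rw [← Finset.add_sum_erase _ _ (Finset.mem_univ k),
      ← Finset.add_sum_erase _ y (Finset.mem_univ k),
      Finset.sum_congr rfl fun j hj => h j (Finset.ne_of_mem_erase hj)] at hsum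
    exact add_right_cancel hsum
  · exact h k hk

lemma halfSumFamily_mem_latticeN {n : ℕ} (i j : Fin n) :
    halfSumFamily i j ∈ latticeN 1 n := by
  refine ⟨fun k => ?_, 1, by simp [sum_halfSumFamily]⟩
  unfold halfSumFamily
  split_ifs with h
  · exact ⟨2 * Pi.single (M := fun _ => ℤ) i 1 k, by
      simp only [Pi.single_apply]; split_ifs <;> norm_num⟩
  · refine ⟨Pi.single (M := fun _ => ℤ) i 1 k + Pi.single (M := fun _ => ℤ) j 1 k, ?_⟩
    simp only [Pi.smul_apply, Pi.add_apply, Pi.single_apply, smul_eq_mul]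
    split_ifs <;> norm_num

lemma linearIndependent_halfSumFamily {n : ℕ} (i : Fin n) :
    LinearIndependent ℤ (halfSumFamily i) := by
  rw [Fintype.linearIndependent_iff]
  intro c hc
  refine congrFun (eq_of_sum_eq_of_forall_ne (y := 0) i ?_ fun k hk => ?_)
  · have h := sum_linearCombination_halfSumFamily i c
    rw [hc] at h
    simp only [Pi.zero_apply, Finset.sum_const_zero] at h ⊢
    exact_mod_cast h.symm
  · have h := linearCombination_halfSumFamily_apply_of_ne c hk
    rw [hc] at h
    simpa using h.symm

lemma span_halfSumFamily {n : ℕ} (i : Fin n) :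
    Submodule.span ℤ (Set.range (halfSumFamily i)) = latticeN 1 n := by
  refine le_antisymm ?_ fun x hx => ?_
  · rw [Submodule.span_le]
    rintro _ ⟨j, rfl⟩
    exact halfSumFamily_mem_latticeN i j
  · obtain ⟨hcoord, s, hs⟩ := hx
    choose m hm using hcoord
    rw [Submodule.mem_span_range_iff_exists_fun]
    refine ⟨Function.update m i (s - ∑ k ∈ Finset.univ.erase i, m k),
      eq_of_sum_eq_of_forall_ne i ?_ fun k hk => ?_⟩
    · rw [sum_linearCombination_halfSumFamily, hs, ← Int.cast_sum,
        Finset.sum_update_of_mem (Finset.mem_univ i), Finset.sdiff_singleton_eq_erase,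
        sub_add_cancel]
    · rw [linearCombination_halfSumFamily_apply_of_ne _ hk, Function.update_of_ne hk, ← hm k]
      push_cast
      ring

/-- For `n ≥ 2` and each `i`, the vectors `e^i` and
`v^{i,j} = (e^i + e^j)/2` for `j ≠ i` form a `ℤ`-basis of the lattice
`N = {x ∈ ℚ^n : 2x ∈ ℤ^n, ∑ x_i ∈ ℤ}` associated to `A_1(n)`. -/
theorem basis_of_latticeN_A1n (n : ℕ) (hn : 2 ≤ n) (i : Fin n) :
    let fam : Fin n → Fin n → ℚ := fun j =>
      if j = i then Pi.single i 1 else (1 / 2 : ℚ) • (Pi.single i 1 + Pi.single j 1)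
    (∀ j, fam j ∈ latticeN 1 n) ∧ LinearIndependent ℤ fam ∧
      Submodule.span ℤ (Set.range fam) = latticeN 1 n := by
  exact ⟨halfSumFamily_mem_latticeN i, linearIndependent_halfSumFamily i,
    span_halfSumFamily i⟩
end

section
/- Let N := { x ∈ ℚ^4 : 2x ∈ ℤ^4 and x_1 + x_2 + x_3 + x_4 ∈ ℤ }. Then for each index 1 ≤ i ≤ 4, the three vectors v^{i,j} := (e^i + e^j)/2 for j ≠ i, together with the vector c' := (1/2)(e^1 + e^2 + e^3 + e^4), form a ℤ-basis of N. -/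
/-- Twice the `k`-th coordinate of an integer combination of the vectors `(e^i + e^j)/2`, `j ≠ i`,
and the constant vector `1/2`, the latter carrying the coefficient `c i`. -/
theorem two_mul_sum_smul_apply (i : Fin 4) (c : Fin 4 → ℤ) (k : Fin 4) :
    2 * (∑ j, c j • (if j = i then (fun _ => 1 / 2)
      else (1 / 2 : ℚ) • (Pi.single i 1 + Pi.single j 1) : Fin 4 → ℚ)) k =
      if k = i then ∑ j, (c j : ℚ) else c i + c k := by
  fin_cases i <;> fin_cases k <;> simp [Fin.sum_univ_four] <;> ring

/-- In `ℚ^4`, for each `i`, the three vectors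
`v^{i,j} = (e^i + e^j)/2` (`j ≠ i`) together with `c' = (1/2)(e^1+e^2+e^3+e^4)`
form a `ℤ`-basis of the lattice `N = {x ∈ ℚ^4 : 2x ∈ ℤ^4, ∑ x_i ∈ ℤ}`. -/
theorem basis_of_latticeN_A14_with_center (i : Fin 4) :
    let fam : Fin 4 → Fin 4 → ℚ := fun j =>
      if j = i then (fun _ => 1 / 2)
      else (1 / 2 : ℚ) • (Pi.single i 1 + Pi.single j 1)
    (∀ j, fam j ∈ latticeN 1 4) ∧ LinearIndependent ℤ fam ∧
      Submodule.span ℤ (Set.range fam) = latticeN 1 4 := by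
  intro fam
  have coord (c : Fin 4 → ℤ) (k : Fin 4) :
      2 * (∑ j, c j • fam j) k = if k = i then ∑ j, (c j : ℚ) else c i + c k :=
    two_mul_sum_smul_apply i c k
  have mem (j : Fin 4) : fam j ∈ latticeN 1 4 := by
    by_cases hj : j = i
    · refine ⟨fun k => ⟨1, ?_⟩, 2, ?_⟩ <;> simp [fam, hj] <;> norm_num
    · refine ⟨fun k => ⟨(Pi.single i 1 + Pi.single j 1 : Fin 4 → ℤ) k, ?_⟩, 1, ?_⟩
      · simp only [fam, hj, if_false, Pi.smul_apply, Pi.add_apply, Pi.single_apply, smul_eq_mul]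
        push_cast
        ring
      · simp only [fam, hj, if_false, Pi.smul_apply, Pi.add_apply, smul_eq_mul,
          ← Finset.mul_sum, Finset.sum_add_distrib, Finset.sum_pi_single', Finset.mem_univ, if_true]
        norm_num
  refine ⟨mem, ?_, le_antisymm (Submodule.span_le.2 ?_) ?_⟩
  · rw [Fintype.linearIndependent_iff]
    intro c hc
    have h (k : Fin 4) := coord c k
    simp only [hc, Pi.zero_apply, mul_zero, Fin.sum_univ_four] at h
    norm_cast at h
    have h0 := h 0
    have h1 := h 1
    have h2 := h 2
    have h3 := h 3
    intro j
    fin_cases i <;> fin_cases j <;> simp at h0 h1 h2 h3 ⊢ <;> lia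
  · rintro _ ⟨j, rfl⟩
    exact mem j
  · rintro x ⟨hx, s, hs⟩
    choose m hm using hx
    rw [Submodule.mem_span_range_iff_exists_fun]
    refine ⟨fun j => if j = i then s - m i else m j - (s - m i), ?_⟩
    ext k
    refine mul_left_cancel₀ (two_ne_zero' ℚ) ?_
    rw [coord]
    simp only [Fin.sum_univ_four, Nat.cast_one] at hs hm ⊢
    have h0 := hm 0
    have h1 := hm 1
    have h2 := hm 2
    have h3 := hm 3
    fin_cases i <;> fin_cases k <;> simp <;> linarith
end

section
/- Let r ≥ 1 and let N := { x ∈ ℚ^3 : (r+1)x ∈ ℤ^3 and x_1 + x_2 + x_3 ∈ ℤ }, and for non-negative integers m_1, m_2, m_3 with m_1 + m_2 + m_3 = r+1 set v^{m_1,m_2,m_3} := (m_1 e^1 + m_2 e^2 + m_3 e^3)/(r+1). Then: (a) if m_1 ≥ 1, the three vectors v^{m_1,m_2,m_3}, v^{m_1-1,m_2+1,m_3}, v^{m_1-1,m_2,m_3+1} form a ℤ-basis of N; and (b) if m_1 ≥ 1 and m_3 ≥ 1, the three vectors v^{m_1,m_2,m_3}, v^{m_1-1,m_2+1,m_3}, v^{m_1,m_2+1,m_3-1}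 form a ℤ-basis of N. -/
/-- A vector with coordinates `a/(r+1), b/(r+1), c/(r+1)` lies in `N` when
`a + b + c = r + 1`. -/
theorem vec_div_mem_latticeN {r a b c : ℕ} (h : a + b + c = r + 1) :
    ![(a : ℚ) / (r + 1), (b : ℚ) / (r + 1), (c : ℚ) / (r + 1)] ∈ latticeN r 3 := by
  have hr : (r : ℚ) + 1 ≠ 0 := by positivity
  have hQ : (a : ℚ) + b + c = r + 1 := by exact_mod_cast h
  refine ⟨fun i => ?_, 1, ?_⟩
  · fin_cases i
    · exact ⟨a, by simp; field_simp⟩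
    · exact ⟨b, by simp; field_simp⟩
    · exact ⟨c, by simp; field_simp⟩
  · simp only [Fin.sum_univ_three, Matrix.cons_val, Int.cast_one]
    field_simp
    exact hQ

/-- Three vectors of `N` form a basis as soon as they have no nontrivial integral relation
and every element of `N` is an integral combination of them. -/
theorem basis_latticeN_of_forall {r : ℕ} {u v w : Fin 3 → ℚ}
    (hu : u ∈ latticeN r 3) (hv : v ∈ latticeN r 3) (hw : w ∈ latticeN r 3)
    (hind : ∀ x y z : ℤ, x • u + y • v + z • w = 0 → x = 0 ∧ y = 0 ∧ z = 0)
    (hspan : ∀ t ∈ latticeN r 3, ∃ x y z : ℤ, x • u + y • v + z • w = t) :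
    (∀ j, ![u, v, w] j ∈ latticeN r 3) ∧ LinearIndependent ℤ ![u, v, w] ∧
      Submodule.span ℤ (Set.range ![u, v, w]) = latticeN r 3 := by
  have hmem : ∀ j, ![u, v, w] j ∈ latticeN r 3 := by
    intro j
    fin_cases j
    exacts [hu, hv, hw]
  refine ⟨hmem, ?_, le_antisymm ?_ fun t ht => ?_⟩
  · rw [Fintype.linearIndependent_iff]
    intro g hg
    rw [Fin.sum_univ_three] at hg
    obtain ⟨h0, h1, h2⟩ := hind _ _ _ hg
    intro i
    fin_cases i
    exacts [h0, h1, h2]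
  · rw [Submodule.span_le]
    rintro _ ⟨j, rfl⟩
    exact hmem j
  · obtain ⟨x, y, z, h⟩ := hspan t ht
    rw [Submodule.mem_span_range_iff_exists_fun]
    exact ⟨![x, y, z], by rw [Fin.sum_univ_three]; exact h⟩

/-- Let `N = {x ∈ ℚ^3 : (r+1)x ∈ ℤ^3, ∑ x_i ∈ ℤ}` and
`v^{m_1,m_2,m_3} = (m_1e^1 + m_2e^2 + m_3e^3)/(r+1)` for `m_1+m_2+m_3 = r+1`.
(a) If `m_1 ≥ 1` then `v^{m_1,m_2,m_3}, v^{m_1−1,m_2+1,m_3}, v^{m_1−1,m_2,m_3+1}`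
form a `ℤ`-basis of `N`; (b) if moreover `m_3 ≥ 1` then
`v^{m_1,m_2,m_3}, v^{m_1−1,m_2+1,m_3}, v^{m_1,m_2+1,m_3−1}` form a `ℤ`-basis of `N`. -/
theorem basis_of_latticeN_Ar3 (r m1 m2 m3 : ℕ) (hr : 1 ≤ r)
    (hsum : m1 + m2 + m3 = r + 1) :
    let v : ℕ → ℕ → ℕ → Fin 3 → ℚ := fun a b c =>
      ![(a : ℚ) / (r + 1), (b : ℚ) / (r + 1), (c : ℚ) / (r + 1)]
    (1 ≤ m1 →
      (let fam : Fin 3 → Fin 3 → ℚ :=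
        ![v m1 m2 m3, v (m1 - 1) (m2 + 1) m3, v (m1 - 1) m2 (m3 + 1)]
       (∀ j, fam j ∈ latticeN r 3) ∧ LinearIndependent ℤ fam ∧
         Submodule.span ℤ (Set.range fam) = latticeN r 3)) ∧
    (1 ≤ m1 → 1 ≤ m3 →
      (let fam : Fin 3 → Fin 3 → ℚ :=
        ![v m1 m2 m3, v (m1 - 1) (m2 + 1) m3, v m1 (m2 + 1) (m3 - 1)]
       (∀ j, fam j ∈ latticeN r 3) ∧ LinearIndependent ℤ fam ∧
         Submodule.span ℤ (Set.range fam) = latticeN r 3)) := by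
  intro v
  have hR : (r : ℚ) + 1 ≠ 0 := by positivity
  have hS : (m1 : ℚ) + m2 + m3 = r + 1 := by exact_mod_cast hsum
  refine ⟨fun h1 => ?_, fun h1 h3 => ?_⟩
  · refine basis_latticeN_of_forall (vec_div_mem_latticeN (by omega))
      (vec_div_mem_latticeN (by omega)) (vec_div_mem_latticeN (by omega)) ?_ ?_
    · intro x y z h
      have e0 := congrFun h 0
      have e1 := congrFun h 1
      have e2 := congrFun h 2
      simp [v, Nat.cast_sub h1] at e0 e1 e2
      field_simp at e0 e1 e2
      have hk : (x : ℚ) + y + z = 0 := by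
        refine (mul_eq_zero.mp ?_).resolve_left hR
        linear_combination e0 + e1 + e2 - (x + y + z : ℚ) * hS
      refine ⟨?_, ?_, ?_⟩
      · exact_mod_cast (by linear_combination e0 - (m1 - 1 : ℚ) * hk : (x : ℚ) = 0)
      · exact_mod_cast (by linear_combination e1 - (m2 : ℚ) * hk : (y : ℚ) = 0)
      · exact_mod_cast (by linear_combination e2 - (m3 : ℚ) * hk : (z : ℚ) = 0)
    · rintro t ⟨ht, k, hk⟩
      obtain ⟨p, hp⟩ := ht 0
      obtain ⟨q, hq⟩ := ht 1
      obtain ⟨s, hs⟩ := ht 2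
      rw [Fin.sum_univ_three] at hk
      have hpqs : (p : ℚ) + q + s = (r + 1) * k := by
        linear_combination (r + 1 : ℚ) * hk - hp - hq - hs
      refine ⟨p - (m1 - 1) * k, q - m2 * k, s - m3 * k, ?_⟩
      ext i
      apply mul_left_cancel₀ hR
      fin_cases i <;> simp [v, Nat.cast_sub h1, -mul_eq_mul_left_iff] <;> field_simp
      · linear_combination (m1 - 1 : ℚ) * (hpqs - k * hS) - hp
      · linear_combination (m2 : ℚ) * (hpqs - k * hS) - hq
      · linear_combination (m3 : ℚ) * (hpqs - k * hS) - hs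
  · refine basis_latticeN_of_forall (vec_div_mem_latticeN (by omega))
      (vec_div_mem_latticeN (by omega)) (vec_div_mem_latticeN (by omega)) ?_ ?_
    · intro x y z h
      have e0 := congrFun h 0
      have e1 := congrFun h 1
      have e2 := congrFun h 2
      simp [v, Nat.cast_sub h1, Nat.cast_sub h3] at e0 e1 e2
      field_simp at e0 e1 e2
      have hk : (x : ℚ) + y + z = 0 := by
        refine (mul_eq_zero.mp ?_).resolve_left hR
        linear_combination e0 + e1 + e2 - (x + y + z : ℚ) * hS
      refine ⟨?_, ?_, ?_⟩
      · exact_mod_cast (by linear_combination (m2 + 1 : ℚ) * hk - e1 : (x : ℚ) = 0)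
      · exact_mod_cast (by linear_combination (m1 : ℚ) * hk - e0 : (y : ℚ) = 0)
      · exact_mod_cast (by linear_combination (m3 : ℚ) * hk - e2 : (z : ℚ) = 0)
    · rintro t ⟨ht, k, hk⟩
      obtain ⟨p, hp⟩ := ht 0
      obtain ⟨q, hq⟩ := ht 1
      obtain ⟨s, hs⟩ := ht 2
      rw [Fin.sum_univ_three] at hk
      have hpqs : (p : ℚ) + q + s = (r + 1) * k := by
        linear_combination (r + 1 : ℚ) * hk - hp - hq - hs
      refine ⟨(m2 + 1) * k - q, m1 * k - p, m3 * k - s, ?_⟩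
      ext i
      apply mul_left_cancel₀ hR
      fin_cases i <;> simp [v, Nat.cast_sub h1, Nat.cast_sub h3, -mul_eq_mul_left_iff] <;> field_simp
      · linear_combination (m1 : ℚ) * (k * hS - hpqs) - hp
      · linear_combination (m2 + 1 : ℚ) * (k * hS - hpqs) - hq
      · linear_combination (m3 : ℚ) * (k * hS - hpqs) - hs
end

section
/- Let n ≥ 2, let G = A_1(n) act on ℂ[Z_1,…,Z_n] by g·Z_i = g_{ii} Z_i, and fix 1 ≤ j ≤ n. Then the ideal I(x_j) = ⟨Z_j⟩ + ⟨Z_i^2 : i ≠ j⟩ + ⟨Z_1^2, …, Z_n^2, Z_1⋯Z_n⟩ is G-invariant, the quotient ℂ[Z_1,…,Z_n]/I(x_j) has dimension 2^{n-1} with basis the classes of the monomials Z^I with i_j = 0 and i_k ∈ {0,1} for k ≠ j, and it is isomorphic to the regular representation of G, i.e. each of the 2^{n-1} characters of G occurs in it with multiplicity one. -/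
open MvPolynomial

noncomputable section

/-- The ideal generated by `X j`, the product of all variables and the squares of the variables. -/
def idealX {n : ℕ} (j : Fin n) : Ideal (MvPolynomial (Fin n) ℂ) :=
  Ideal.span (insert (X j) (insert (∏ i, (X i : MvPolynomial (Fin n) ℂ))
    (Set.range fun i : Fin n => (X i : MvPolynomial (Fin n) ℂ) ^ 2)))

/-- The exponents of the monomials outside `idealX j`. -/
abbrev StdExp {n : ℕ} (j : Fin n) : Type :=
  {E : Fin n →₀ ℕ // E j = 0 ∧ ∀ k, E k ≤ 1}

theorem idealX_eq_span_monomial {n : ℕ} (j : Fin n) :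
    idealX j = Ideal.span ((fun s => monomial s (1 : ℂ)) ''
      insert (Finsupp.single j 1) (insert (∑ i, Finsupp.single i 1)
        (Set.range fun i : Fin n => Finsupp.single i 2))) := by
  have hprod : monomial (∑ i : Fin n, Finsupp.single i 1) (1 : ℂ) = ∏ i, X i := by
    rw [monomial_sum_one]
    rfl
  rw [idealX, Set.image_insert_eq, Set.image_insert_eq, ← Set.range_comp, hprod]
  simp only [Function.comp_def, X_pow_eq_monomial]
  rfl

theorem mem_idealX_iff {n : ℕ} (j : Fin n) (p : MvPolynomial (Fin n) ℂ) :
    p ∈ idealX j ↔ ∀ E : StdExp j, coeff E.1 p = 0 := by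
  rw [idealX_eq_span_monomial, mem_ideal_span_monomial_image]
  constructor
  · rintro h ⟨E, hj, hE⟩
    by_contra hne
    obtain ⟨s, hs, hle⟩ := h E (mem_support_iff.mpr hne)
    rcases hs with rfl | rfl | ⟨i, rfl⟩
    · have := hle j
      simp [hj] at this
    · have := hle j
      simp [hj, Finsupp.finsetSum_apply, Finsupp.single_apply] at this
    · have := hle i
      have := hE i
      simp at *
      omega
  · intro h E hE
    by_cases hj : E j = 0
    · by_cases hk : ∀ k, E k ≤ 1
      · exact absurd (h ⟨E, hj, hk⟩) (mem_support_iff.mp hE)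
      · push Not at hk
        obtain ⟨k, hk⟩ := hk
        exact ⟨_, Or.inr (Or.inr ⟨k, rfl⟩), Finsupp.single_le_iff.mpr hk⟩
    · exact ⟨_, Or.inl rfl, Finsupp.single_le_iff.mpr (Nat.one_le_iff_ne_zero.mpr hj)⟩

theorem coeff_actA_s19 {n : ℕ} (d : Fin n → ℂˣ) (E : Fin n →₀ ℕ) (p : MvPolynomial (Fin n) ℂ) :
    coeff E (actA d p) = (∏ i, (d i : ℂ) ^ E i) * coeff E p := by
  induction p using MvPolynomial.induction_on' with
  | monomial u a =>
    have : actA d (monomial u a) = monomial u ((∏ i, (d i : ℂ) ^ u i) * a) := by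
      rw [actA, aeval_monomial, Finsupp.prod_fintype _ _ (fun i => pow_zero _)]
      simp only [mul_pow, Finset.prod_mul_distrib, algebraMap_eq, ← C_pow]
      rw [monomial_eq (s := u), Finsupp.prod_fintype _ _ (fun i => pow_zero _), C_mul, map_prod]
      ring
    rw [this, coeff_monomial, coeff_monomial]
    split_ifs with h
    · rw [h]
    · rw [mul_zero]
  | add p q hp hq => rw [map_add, coeff_add, coeff_add, hp, hq, mul_add]

/-- The set of positions at which a standard exponent is one. -/
def stdExpEquiv {n : ℕ} (j : Fin n) : StdExp j ≃ Finset {k : Fin n // k ≠ j} where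
  toFun E := {k | E.1 k.1 = 1}
  invFun s := ⟨Finsupp.equivFunOnFinite.symm fun k => if h : k ≠ j then
      (if (⟨k, h⟩ : {k : Fin n // k ≠ j}) ∈ s then 1 else 0) else 0, by simp, fun k => by
        simp only [Finsupp.coe_equivFunOnFinite_symm]
        split_ifs <;> simp⟩
  left_inv := by
    rintro ⟨E, hj, hE⟩
    ext k
    have := hE k
    by_cases h : k = j
    · simp [h, hj]
    · simp only [Finset.mem_filter_univ, Finsupp.coe_equivFunOnFinite_symm, dif_pos (Ne.intro h)]
      split_ifs <;> omega
  right_inv s := by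
    ext ⟨k, hk⟩
    simp [hk]

instance {n : ℕ} (j : Fin n) : Fintype (StdExp j) :=
  Fintype.ofEquiv _ (stdExpEquiv j).symm

theorem card_stdExp {n : ℕ} (j : Fin n) : Fintype.card (StdExp j) = 2 ^ (n - 1) := by
  rw [Fintype.card_congr (stdExpEquiv j), Fintype.card_finset]
  simp [Fintype.card_subtype_compl]

/-- The coefficients of a polynomial at the standard exponents. -/
def stdCoeff {n : ℕ} (j : Fin n) : MvPolynomial (Fin n) ℂ →ₗ[ℂ] (StdExp j → ℂ) :=
  LinearMap.pi fun E => lcoeff ℂ E.1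

theorem stdCoeff_apply {n : ℕ} (j : Fin n) (p : MvPolynomial (Fin n) ℂ) (E : StdExp j) :
    stdCoeff j p E = coeff E.1 p := rfl

theorem stdCoeff_monomial {n : ℕ} (j : Fin n) (E : StdExp j) :
    stdCoeff j (monomial E.1 1) = Pi.single E 1 := by
  ext F
  simp [stdCoeff_apply, coeff_monomial, Pi.single_apply, Subtype.ext_iff, eq_comm]

theorem stdCoeff_surjective {n : ℕ} (j : Fin n) : Function.Surjective (stdCoeff j) := by
  intro f
  refine ⟨∑ E, f E • monomial E.1 1, ?_⟩
  simp only [map_sum, map_smul, stdCoeff_monomial]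
  exact (pi_eq_sum_univ' f).symm

theorem ker_stdCoeff {n : ℕ} (j : Fin n) :
    (idealX j).restrictScalars ℂ = LinearMap.ker (stdCoeff j) := by
  ext p
  rw [Submodule.restrictScalars_mem, mem_idealX_iff, LinearMap.mem_ker, funext_iff]
  rfl

/-- The coordinates on the quotient by `idealX j` given by the standard monomials. -/
def quotEquiv {n : ℕ} (j : Fin n) :
    (MvPolynomial (Fin n) ℂ ⧸ idealX j) ≃ₗ[ℂ] (StdExp j → ℂ) :=
  (Submodule.Quotient.restrictScalarsEquiv ℂ (idealX j)).symm ≪≫ₗ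
    Submodule.quotEquivOfEq _ _ (ker_stdCoeff j) ≪≫ₗ
    (stdCoeff j).quotKerEquivOfSurjective (stdCoeff_surjective j)

theorem quotEquiv_mk {n : ℕ} (j : Fin n) (p : MvPolynomial (Fin n) ℂ) :
    quotEquiv j (Ideal.Quotient.mk _ p) = stdCoeff j p := rfl

/-- The basis of the quotient by `idealX j` consisting of the standard monomials. -/
def stdBasis {n : ℕ} (j : Fin n) :
    Module.Basis (StdExp j) ℂ (MvPolynomial (Fin n) ℂ ⧸ idealX j) :=
  Module.Basis.ofEquivFun (quotEquiv j)

theorem coe_stdBasis {n : ℕ} (j : Fin n) :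
    ⇑(stdBasis j) = fun E => Ideal.Quotient.mk (idealX j) (monomial E.1 (1 : ℂ)) := by
  ext E
  rw [stdBasis, Module.Basis.coe_ofEquivFun, LinearEquiv.symm_apply_eq, quotEquiv_mk,
    stdCoeff_monomial]

theorem mk_mem_iso_iff {n : ℕ} (j : Fin n) (ρ : ArGroup 1 n →* ℂˣ)
    (w : MvPolynomial (Fin n) ℂ ⧸ idealX j) :
    w ∈ iso 1 n (idealX j) ρ ↔ ∀ (g : ArGroup 1 n) (E : StdExp j),
      (∏ i, (g.1 i : ℂ) ^ E.1 i) * quotEquiv j w E = (ρ g : ℂ) * quotEquiv j w E := by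
  have key (g : ArGroup 1 n) (p : MvPolynomial (Fin n) ℂ) :
      Ideal.Quotient.mk (idealX j) (actA g.1 p) = (ρ g : ℂ) • Ideal.Quotient.mk (idealX j) p ↔
        ∀ E : StdExp j, (∏ i, (g.1 i : ℂ) ^ E.1 i) * quotEquiv j (Ideal.Quotient.mk _ p) E =
          (ρ g : ℂ) * quotEquiv j (Ideal.Quotient.mk _ p) E := by
    rw [← (quotEquiv j).injective.eq_iff, map_smul, funext_iff]
    simp only [quotEquiv_mk, stdCoeff_apply, coeff_actA_s19, Pi.smul_apply, smul_eq_mul]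
  constructor
  · intro h g
    obtain ⟨p, rfl⟩ := Ideal.Quotient.mk_surjective w
    exact (key g p).mp (h g p rfl)
  · rintro h g p rfl
    exact (key g p).mpr (h g)

/-- The element of `A_1(n)` changing the signs of the coordinates `j` and `k`
(the identity if `j = k`). -/
def signFlip {n : ℕ} (j k : Fin n) : ArGroup 1 n :=
  ⟨Pi.mulSingle k (-1) * Pi.mulSingle j (-1), fun i => by
    have h (l : Fin n) : (Pi.mulSingle l (-1) : Fin n → ℂˣ) i ^ 2 = 1 := by
      rw [← Pi.pow_apply, ← Pi.mulSingle_pow, neg_one_sq, Pi.mulSingle_one, Pi.one_apply]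
    rw [Pi.mul_apply, mul_pow, h, h, mul_one], by simp [Finset.prod_mul_distrib]⟩

theorem signFlip_self {n : ℕ} (j : Fin n) : signFlip j j = 1 := by
  apply Subtype.ext
  simp [signFlip, ← Pi.mulSingle_mul]

theorem signFlip_sq {n : ℕ} (j k : Fin n) : signFlip j k ^ 2 = 1 :=
  Subtype.ext (funext (signFlip j k).2.1)

theorem prod_mulSingle_pow {n : ℕ} (k : Fin n) (u : ℂˣ) (E : Fin n →₀ ℕ) :
    ∏ i, ((Pi.mulSingle k u : Fin n → ℂˣ) i : ℂ) ^ E i = (u : ℂ) ^ E k := by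
  rw [Finset.prod_eq_single k]
  · simp
  · intro i _ hi
    simp [Pi.mulSingle_eq_of_ne hi]
  · simp

theorem prod_signFlip_pow {n : ℕ} {j : Fin n} (k : Fin n) (E : StdExp j) :
    ∏ i, ((signFlip j k).1 i : ℂ) ^ E.1 i = (-1) ^ E.1 k := by
  simp only [signFlip, Pi.mul_apply, Units.val_mul, mul_pow, Finset.prod_mul_distrib,
    prod_mulSingle_pow, E.2.1]
  simp

theorem units_eq_one_or_neg_one {u : ℂˣ} (h : u ^ 2 = 1) : u = 1 ∨ u = -1 := by
  have h' : (u : ℂ) ^ 2 = 1 := by rw [← Units.val_pow_eq_pow_val, h, Units.val_one]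
  exact (sq_eq_one_iff.mp h').imp Units.ext Units.ext

theorem eq_one_or_neg_one {n : ℕ} (g : ArGroup 1 n) (k : Fin n) : g.1 k = 1 ∨ g.1 k = -1 :=
  units_eq_one_or_neg_one (g.2.1 k)

theorem eq_prod_signFlip {n : ℕ} (j : Fin n) (g : ArGroup 1 n) :
    g = ∏ k, if g.1 k = 1 then 1 else signFlip j k := by
  have h (k : Fin n) : ((if g.1 k = 1 then 1 else signFlip j k : ArGroup 1 n) : Fin n → ℂˣ) =
      Pi.mulSingle k (g.1 k) * Pi.mulSingle j (g.1 k) := by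
    split_ifs with hk
    · simp [hk]
    · rw [(eq_one_or_neg_one g k).resolve_left hk]
      rfl
  apply Subtype.ext
  rw [Subgroup.val_finsetProd]
  simp only [h, Finset.prod_mul_distrib, Finset.univ_prod_mulSingle]
  have hj := map_prod (MonoidHom.mulSingle (fun _ : Fin n => ℂˣ) j) g.1 Finset.univ
  rw [g.2.2, map_one] at hj
  exact (mul_one _).symm.trans (congrArg _ hj)

theorem existsUnique_stdExp {n : ℕ} (j : Fin n) (ρ : ArGroup 1 n →* ℂˣ) :
    ∃! E : StdExp j, ∀ g : ArGroup 1 n, ∏ i, (g.1 i : ℂ) ^ E.1 i = ρ g := by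
  classical
  refine ⟨⟨Finsupp.equivFunOnFinite.symm fun k => if ρ (signFlip j k) = 1 then 0 else 1,
    by simp [signFlip_self], fun k => ?_⟩, fun g => ?_, fun F hF => ?_⟩
  · simp only [Finsupp.coe_equivFunOnFinite_symm]
    split_ifs <;> simp
  · conv_rhs => rw [eq_prod_signFlip j g]
    rw [map_prod, Units.coe_prod]
    refine Finset.prod_congr rfl fun k _ => ?_
    rcases eq_one_or_neg_one g k with hk | hk
    · simp [hk]
    · have hne : (-1 : ℂˣ) ≠ 1 := by
        rw [Ne, Units.ext_iff]
        norm_num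
      rw [hk, if_neg hne]
      have hsq : ρ (signFlip j k) ^ 2 = 1 := by rw [← map_pow, signFlip_sq, map_one]
      rcases units_eq_one_or_neg_one hsq with h | h
      · simp [h]
      · simp [h, hne]
  · ext k
    have h := hF (signFlip j k)
    rw [prod_signFlip_pow] at h
    have hle := F.2.2 k
    simp only [Finsupp.coe_equivFunOnFinite_symm]
    interval_cases hk : F.1 k
    · rw [pow_zero, eq_comm, Units.val_eq_one] at h
      simp [h]
    · have : ρ (signFlip j k) ≠ 1 := by
        rintro h1
        rw [h1] at h
        norm_num at h
      simp [this]

theorem exists_mem_iso {n : ℕ} (j : Fin n) (ρ : ArGroup 1 n →* ℂˣ) :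
    ∃ w ∈ iso 1 n (idealX j) ρ, w ≠ 0 ∧ ∀ w' ∈ iso 1 n (idealX j) ρ, ∃ a : ℂ, w' = a • w := by
  obtain ⟨E, hE, huniq⟩ := existsUnique_stdExp j ρ
  have hcoord : quotEquiv j (stdBasis j E) = Pi.single E 1 := by
    rw [coe_stdBasis, quotEquiv_mk, stdCoeff_monomial]
  refine ⟨stdBasis j E, (mk_mem_iso_iff j ρ _).mpr fun g F => ?_, (stdBasis j).ne_zero E,
    fun w hw => ⟨quotEquiv j w E, (quotEquiv j).injective (funext fun F => ?_)⟩⟩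
  · rw [hcoord]
    by_cases hF : F = E
    · rw [hF, hE g]
    · simp [hF]
  · rw [map_smul, hcoord, Pi.smul_apply, smul_eq_mul]
    by_cases hF : F = E
    · simp [hF]
    · rw [Pi.single_eq_of_ne hF, mul_zero]
      by_contra hne
      exact hF (huniq F fun g => mul_right_cancel₀ hne ((mk_mem_iso_iff j ρ w).mp hw g F))

end

/-- For `n ≥ 2`, `G = A_1(n)` and `1 ≤ j ≤ n`, the ideal
`I(x_j) = ⟨Z_j⟩ + ⟨Z_i^2 : i⟩ + ⟨Z_1⋯Z_n⟩` is `G`-invariant, the quotient has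
dimension `2^(n-1)` with basis the classes of the monomials `Z^I` with `I_j = 0`
and `I_k ∈ {0,1}`, and each of the `2^(n-1)` characters of `G` occurs in it with
multiplicity one. -/
theorem A1n_ideal_xj_regular (n : ℕ) (hn : 2 ≤ n) (j : Fin n) :
    let I : Ideal (MvPolynomial (Fin n) ℂ) :=
      Ideal.span (insert (X j) (insert (∏ i, (X i : MvPolynomial (Fin n) ℂ))
        (Set.range fun i : Fin n => (X i : MvPolynomial (Fin n) ℂ) ^ 2)))
    let fam : {E : Fin n →₀ ℕ // E j = 0 ∧ ∀ k, E k ≤ 1} → MvPolynomial (Fin n) ℂ ⧸ I :=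
      fun E => Ideal.Quotient.mk I (monomial E.1 (1 : ℂ))
    (∀ g : ArGroup 1 n, ∀ p ∈ I, actA (g : Fin n → ℂˣ) p ∈ I) ∧
    Module.finrank ℂ (MvPolynomial (Fin n) ℂ ⧸ I) = 2 ^ (n - 1) ∧
    LinearIndependent ℂ fam ∧
    Submodule.span ℂ (Set.range fam) = ⊤ ∧
    ∀ ρ : ArGroup 1 n →* ℂˣ,
      ∃ w ∈ iso 1 n I ρ, w ≠ 0 ∧ ∀ w' ∈ iso 1 n I ρ, ∃ a : ℂ, w' = a • w := by
  intro I fam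
  have hfam : fam = stdBasis j := (coe_stdBasis j).symm
  refine ⟨fun g p hp => ?_, ?_, ?_, ?_, fun ρ => ?_⟩
  · refine (mem_idealX_iff j _).mpr fun E => ?_
    rw [coeff_actA_s19, (mem_idealX_iff j p).mp hp E, mul_zero]
  · exact (Module.finrank_eq_card_basis (stdBasis j)).trans (card_stdExp j)
  · rw [hfam]
    exact (stdBasis j).linearIndependent
  · rw [hfam]
    exact (stdBasis j).span_eq
  · exact exists_mem_iso j ρ
end
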